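/- Let G be a directed graph, C ⊆ V(G), and let G' be obtained from G by bypassing C (for each u,v,w with arcs (u,v) and (v,w) where v ∈ C, add arc (u,w); then delete all vertices of C). Then for any S ⊆ V(G) \ C and any a, b ∈ V(G) \ (C ∪ S), the graph G − S has a directed path from a to b if and only if G' − S has a directed path from a to b. -/

import Mathlib

/-- `b` is reachable from `a` in the directed graph `G` with the vertex set `S`
deleted. -/
def Reach {V : Type*} (G : V → V → Prop) (S : Set V) (a b : V) : Prop :=
  Relation.ReflTransGen (fun u v => u ∉ S ∧ v ∉ S ∧ G u v) a b

/-- Let `G'` be obtained from the finite directed graph `G` by bypassing a vertex set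
`C`: the vertices of `G'` are those outside `C`, and `G'` has an arc `(u,v)` iff `G`
has a path from `u` to `v` all of whose internal vertices lie in `C`. Then for every
`S ⊆ V(G) \ C` and all `a, b ∉ C ∪ S`, `G − S` has a path from `a` to `b` iff
`G' − S` does. -/
theorem stmt8 {V : Type*} [Fintype V] (G : V → V → Prop) (C : Set V)
    (G' : V → V → Prop)
    (hG' : ∀ u v, G' u v ↔ (u ∉ C ∧ v ∉ C ∧
      ∃ w, Relation.ReflTransGen (fun x y => G x y ∧ y ∈ C) u w ∧ G w v))
    (S : Set V) (hS : Disjoint S C)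
    (a b : V) (ha : a ∉ C ∪ S) (hb : b ∉ C ∪ S) :
    Reach G S a b ↔ Reach G' S a b := by
  have haC : a ∉ C := fun h => ha (Or.inl h)
  have haS : a ∉ S := fun h => ha (Or.inr h)
  have hbC : b ∉ C := fun h => hb (Or.inl h)
  have hCS : ∀ x, x ∈ C → x ∉ S := fun x hx hs => Set.disjoint_left.mp hS hs hx
  constructor
  · intro h
    have key : ∃ u, u ∉ C ∧ u ∉ S ∧ Reach G' S a u ∧
        Relation.ReflTransGen (fun x y => G x y ∧ y ∈ C) u b ∧ (b ∉ C → b = u) := by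
      clear hb hbC
      unfold Reach at h
      induction h with
      | refl => exact ⟨a, haC, haS, Relation.ReflTransGen.refl, Relation.ReflTransGen.refl,
          fun _ => rfl⟩
      | @tail x y _ hxy ih =>
        obtain ⟨u, huC, huS, hau, hux, _⟩ := ih
        by_cases hy : y ∈ C
        · exact ⟨u, huC, huS, hau, hux.tail ⟨hxy.2.2, hy⟩, fun h => absurd hy h⟩
        · exact ⟨y, hy, hxy.2.1,
            Relation.ReflTransGen.tail hau
              ⟨huS, hxy.2.1, (hG' u y).mpr ⟨huC, hy, x, hux, hxy.2.2⟩⟩,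
            Relation.ReflTransGen.refl, fun _ => rfl⟩
    obtain ⟨u, _, _, hau, _, hbu⟩ := key
    rw [hbu hbC]
    exact hau
  · intro h
    clear hb hbC
    unfold Reach at h ⊢
    induction h with
    | refl => exact Relation.ReflTransGen.refl
    | @tail x y _ hxy ih =>
      obtain ⟨hx, hy, hg⟩ := hxy
      obtain ⟨_, _, w, hxw, hwy⟩ := (hG' x y).mp hg
      have key : w ∉ S ∧ Relation.ReflTransGen (fun u v => u ∉ S ∧ v ∉ S ∧ G u v) x w := by
        clear hwy
        induction hxw with
        | refl => exact ⟨hx, Relation.ReflTransGen.refl⟩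
        | @tail p q _ hpq ih2 =>
          exact ⟨hCS q hpq.2, ih2.2.tail ⟨ih2.1, hCS q hpq.2, hpq.1⟩⟩
      exact (ih.trans key.2).tail ⟨key.1, hy, hwy⟩
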